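/- Let t_max be the least natural number t₀ such that μ(t) = μ(t₀) for all t ≥ t₀, let c₁ be the largest natural number t such that μ(t) = μ(0) + t, and let c₂ = (t_max − c₁)/2. Fix a natural number t and let d be the minimum of deg_x(w) over all maximum-cardinality b-matchings x of G with the capacity of w set to t. Then d ≤ c₁ + 2c₂; if d ≤ c₁ then μ(t) = μ(0) + d; and if d > c₁ then d − c₁ is even, (d − c₁)/2 ≤ c₂, and μ(t) = μ(0) + c₁ + (d − c₁)/2. -/

import Mathlib

open scoped Classical

/-- The degree of a vertex `v` under an edge-weight assignment `x`:
the sum of the weights of the edges of `G` incident to `v`. -/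
noncomputable def bmDeg {V : Type*} [Fintype V] (G : SimpleGraph V)
    (x : Sym2 V → ℕ) (v : V) : ℕ :=
  ∑ e ∈ Finset.univ.filter (fun e : Sym2 V => e ∈ G.edgeSet ∧ v ∈ e), x e

/-- The cardinality `‖x‖₁` of an edge-weight assignment `x`. -/
noncomputable def bmCard {V : Type*} [Fintype V] (G : SimpleGraph V)
    (x : Sym2 V → ℕ) : ℕ :=
  ∑ e ∈ Finset.univ.filter (fun e : Sym2 V => e ∈ G.edgeSet), x e

/-- `x` is a `b`-matching of `(G, b)`: it is supported on the edges of `G`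
and the degree of every vertex `v` is at most `b v`. -/
def IsBMatching {V : Type*} [Fintype V] (G : SimpleGraph V) (b : V → ℕ)
    (x : Sym2 V → ℕ) : Prop :=
  (∀ e, e ∉ G.edgeSet → x e = 0) ∧ ∀ v, bmDeg G x v ≤ b v

/-- The maximum cardinality of a `b`-matching of `(G, b)`. -/
noncomputable def maxBM {V : Type*} [Fintype V] (G : SimpleGraph V) (b : V → ℕ) : ℕ :=
  sSup {m | ∃ x, IsBMatching G b x ∧ bmCard G x = m}

/-- `mu G b w t` : the maximum cardinality of a `b`-matching of `G` when the
capacity of `w` is set to `t` and every other vertex `v` has capacity `b v`. -/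
noncomputable def mu {V : Type*} [Fintype V] (G : SimpleGraph V) (b : V → ℕ)
    (w : V) (t : ℕ) : ℕ :=
  maxBM G (Function.update b w t)


theorem bm_card_le {V : Type*} [Fintype V] (G : SimpleGraph V) (x : Sym2 V → ℕ) :
    bmCard G x ≤ ∑ v, bmDeg G x v := by
  have h1 : ∀ v, bmDeg G x v =
      ∑ e ∈ Finset.univ.filter (fun e : Sym2 V => e ∈ G.edgeSet), if v ∈ e then x e else 0 := by
    intro v
    unfold bmDeg
    rw [← Finset.sum_filter, Finset.filter_filter]
  simp_rw [h1]
  rw [Finset.sum_comm]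
  unfold bmCard
  apply Finset.sum_le_sum
  intro e _
  induction e using Sym2.ind with
  | _ a b =>
    refine le_trans ?_ (Finset.single_le_sum (f := fun v => if v ∈ s(a, b) then x s(a, b) else 0)
      (fun _ _ => Nat.zero_le _) (Finset.mem_univ a))
    simp

theorem bm_bdd {V : Type*} [Fintype V] (G : SimpleGraph V) (b : V → ℕ) :
    BddAbove {m | ∃ x, IsBMatching G b x ∧ bmCard G x = m} := by
  refine ⟨∑ v, b v, ?_⟩
  rintro m ⟨x, hx, rfl⟩
  exact (bm_card_le G x).trans (Finset.sum_le_sum fun v _ => hx.2 v)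

theorem bm_le {V : Type*} [Fintype V] (G : SimpleGraph V) (b : V → ℕ) (x : Sym2 V → ℕ)
    (hx : IsBMatching G b x) : bmCard G x ≤ maxBM G b :=
  le_csSup (bm_bdd G b) ⟨x, hx, rfl⟩

theorem bm_exists {V : Type*} [Fintype V] (G : SimpleGraph V) (b : V → ℕ) :
    ∃ x, IsBMatching G b x ∧ bmCard G x = maxBM G b := by
  have : maxBM G b ∈ {m | ∃ x, IsBMatching G b x ∧ bmCard G x = m} := by
    apply Nat.sSup_mem
    · exact ⟨0, 0, ⟨by simp, by simp [bmDeg]⟩, by simp [bmCard]⟩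
    · exact bm_bdd G b
  exact this

/-- integer degree -/
noncomputable def zdeg {V : Type*} [Fintype V] (G : SimpleGraph V)
    (z : Sym2 V → ℤ) (v : V) : ℤ :=
  ∑ e ∈ Finset.univ.filter (fun e : Sym2 V => e ∈ G.edgeSet ∧ v ∈ e), z e

/-- `p` lies between `0` and `z` -/
def Conf (p z : ℤ) : Prop := (0 ≤ p ∧ p ≤ z) ∨ (z ≤ p ∧ p ≤ 0)

theorem zdeg_sub {V : Type*} [Fintype V] (G : SimpleGraph V) (y z : Sym2 V → ℤ) (v : V) :
    zdeg G (fun e => y e - z e) v = zdeg G y v - zdeg G z v := by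
  simp [zdeg, Finset.sum_sub_distrib]

theorem zdeg_single {V : Type*} [Fintype V] (G : SimpleGraph V) (u v : V) (h : G.Adj u v) (a : V) :
    zdeg G (fun e => if e = s(u, v) then 1 else 0) a
      = (if a = u then 1 else 0) + (if a = v then 1 else 0) := by
  have hne := h.ne
  unfold zdeg
  rw [Finset.sum_ite_eq']
  by_cases h1 : a = u
  · subst h1
    simp [h, hne]
  · by_cases h2 : a = v
    · subst h2
      simp [h, hne.symm]
    · simp [h1, h2]

theorem exists_trail {V : Type*} [Fintype V] (G : SimpleGraph V) : ∀ (n : ℕ) (z : Sym2 V → ℤ)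
    (_ : ∑ e, (z e).natAbs = n) (u : V) (_ : 1 ≤ zdeg G z u),
    ∃ p : Sym2 V → ℤ, (∀ e, Conf (p e) (z e)) ∧ (∀ a, Conf (zdeg G p a) (zdeg G z a)) ∧
      1 ≤ zdeg G p u ∧ ∃ v : V, ∃ ε : ℤ, (ε = 1 ∨ ε = -1) ∧
        ∀ a, zdeg G p a = (if a = u then 1 else 0) + ε * (if a = v then 1 else 0) := by
  intro n
  induction n using Nat.strong_induction_on with
  | _ n ih =>
  intro z hz u hu
  have hex : ∃ v, G.Adj u v ∧ 1 ≤ z s(u, v) := by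
    by_contra hcon
    push Not at hcon
    have : zdeg G z u ≤ 0 := by
      apply Finset.sum_nonpos
      intro e he
      rw [Finset.mem_filter] at he
      obtain ⟨-, he1, he2⟩ := he
      obtain ⟨v, rfl⟩ := he2
      have := hcon v he1
      omega
    omega
  obtain ⟨v, hadj, hpos⟩ := hex
  have hne := hadj.ne
  have hs := zdeg_single G u v hadj
  set s : Sym2 V → ℤ := fun e => if e = s(u, v) then 1 else 0 with hsdef
  by_cases hv : 1 ≤ zdeg G z v
  · refine ⟨s, ?_, ?_, ?_, v, 1, Or.inl rfl, ?_⟩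
    · intro e
      by_cases he : e = s(u, v)
      · subst he; simp [s, Conf]; omega
      · simp [s, he, Conf]; omega
    · intro a
      rw [hs a]
      by_cases h1 : a = u
      · subst h1; simp [hne, Conf]; omega
      · by_cases h2 : a = v
        · subst h2; simp [h1, Conf]; omega
        · simp [h1, h2, Conf]; omega
    · rw [hs]; simp [hne]
    · intro a; rw [hs a]; ring
  · have hdz : ∀ a, zdeg G (fun e => s e - z e) a = zdeg G s a - zdeg G z a := zdeg_sub G s z
    have hlt : ∑ e, (s e - z e).natAbs < n := by
      rw [← hz]
      apply Finset.sum_lt_sum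
      · intro e _
        by_cases he : e = s(u, v)
        · subst he; simp [s]; omega
        · simp [s, he]
      · exact ⟨s(u, v), Finset.mem_univ _, by simp [s]; omega⟩
    obtain ⟨q, hq1, hq2, hq3, v', ε, hε, hq4⟩ := ih _ hlt (fun e => s e - z e) rfl v (by
      rw [hdz, hs]; simp [hne.symm]; omega)
    have hp : ∀ a, zdeg G (fun e => s e - q e) a = zdeg G s a - zdeg G q a := zdeg_sub G s q
    have key : ∀ a, zdeg G (fun e => s e - q e) a
        = (if a = u then 1 else 0) + -ε * (if a = v' then 1 else 0) := by
      intro a; rw [hp, hs, hq4]; ring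
    have hc : ∀ a, Conf (zdeg G (fun e => s e - q e) a) (zdeg G z a) := by
      intro a
      have h2 := hq2 a
      rw [hdz, hs, hq4] at h2
      rw [hq4] at hq3
      rw [key]
      unfold Conf at *
      by_cases h1 : a = u
      · subst h1
        by_cases h3 : a = v'
        · subst h3
          simp [hne] at h2 ⊢
          omega
        · simp [hne, h3] at h2 ⊢
          omega
      · by_cases h4 : a = v
        · subst h4
          by_cases h3 : a = v'
          · subst h3
            simp [h1] at h2 hq3 ⊢
            omega
          · simp [h1, h3] at h2 ⊢
            omega
        · by_cases h3 : a = v'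
          · subst h3
            simp [h1, h4] at h2 ⊢
            omega
          · simp [h1, h4, h3]
            omega
    refine ⟨fun e => s e - q e, ?_, hc, ?_, v', -ε, by omega, key⟩
    · intro e
      have := hq1 e
      unfold Conf at *
      by_cases he : e = s(u, v)
      · subst he; simp [s] at this ⊢; omega
      · simp [s, he] at this ⊢; omega
    · have h2 := hq2 u
      rw [hdz, hs] at h2
      rw [hp, hs]
      unfold Conf at h2
      simp [hne] at h2 ⊢
      omega

theorem mu_le {V : Type*} [Fintype V] (G : SimpleGraph V) (b : V → ℕ) (w : V) (t : ℕ)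
    (x : Sym2 V → ℕ) (h0 : ∀ e, e ∉ G.edgeSet → x e = 0)
    (h1 : ∀ v, v ≠ w → bmDeg G x v ≤ b v) (h2 : bmDeg G x w ≤ t) : bmCard G x ≤ mu G b w t := by
  apply bm_le
  refine ⟨h0, fun v => ?_⟩
  by_cases h : v = w
  · subst h; simpa using h2
  · simpa [h] using h1 v h

theorem mu_exists {V : Type*} [Fintype V] (G : SimpleGraph V) (b : V → ℕ) (w : V) (t : ℕ) :
    ∃ x : Sym2 V → ℕ, (∀ e, e ∉ G.edgeSet → x e = 0) ∧ (∀ v, v ≠ w → bmDeg G x v ≤ b v) ∧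
      bmDeg G x w ≤ t ∧ bmCard G x = mu G b w t := by
  obtain ⟨x, hx, hc⟩ := bm_exists G (Function.update b w t)
  refine ⟨x, hx.1, fun v hv => ?_, ?_, hc⟩
  · simpa [hv] using hx.2 v
  · simpa using hx.2 w

theorem mu_mono {V : Type*} [Fintype V] (G : SimpleGraph V) (b : V → ℕ) (w : V) :
    Monotone (mu G b w) := by
  intro s t hst
  obtain ⟨x, h0, h1, h2, h3⟩ := mu_exists G b w s
  rw [← h3]
  exact mu_le G b w t x h0 h1 (h2.trans hst)

theorem mu_succ_le {V : Type*} [Fintype V] (G : SimpleGraph V) (b : V → ℕ) (w : V) (t : ℕ) :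
    mu G b w (t + 1) ≤ mu G b w t + 1 := by
  obtain ⟨x, h0, h1, h2, h3⟩ := mu_exists G b w (t + 1)
  rw [← h3]
  by_cases h : bmDeg G x w ≤ t
  · exact (mu_le G b w t x h0 h1 h).trans (Nat.le_succ _)
  have hex : ∃ e, e ∈ G.edgeSet ∧ w ∈ e ∧ 0 < x e := by
    by_contra hcon
    push Not at hcon
    have : bmDeg G x w = 0 := by
      apply Finset.sum_eq_zero
      intro e he
      rw [Finset.mem_filter] at he
      have := hcon e he.2.1 he.2.2
      omega
    omega
  obtain ⟨e, he1, he2, he3⟩ := hex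
  let x' : Sym2 V → ℕ := fun a => x a - if a = e then 1 else 0
  have hle : ∀ a, x' a ≤ x a := fun a => Nat.sub_le _ _
  have hsum : ∀ S : Finset (Sym2 V), e ∈ S → ∑ a ∈ S, x a = ∑ a ∈ S, x' a + 1 := by
    intro S hS
    have : ∑ a ∈ S, x a = ∑ a ∈ S, (x' a + if a = e then 1 else 0) := by
      apply Finset.sum_congr rfl
      intro a _
      by_cases ha : a = e
      · subst ha; simp [x']; omega
      · simp [x', ha]
    rw [this, Finset.sum_add_distrib, Finset.sum_ite_eq', if_pos hS]
  have hcard : bmCard G x = bmCard G x' + 1 := hsum _ (by simp [he1])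
  have hdeg : bmDeg G x w = bmDeg G x' w + 1 := hsum _ (by simp [he1, he2])
  rw [hcard]
  have := mu_le G b w t x' (fun a ha => Nat.le_zero.1 ((hle a).trans (h0 a ha).le))
    (fun v hv => (Finset.sum_le_sum fun a _ => hle a).trans (h1 v hv)) (by omega)
  omega

theorem zdeg_cast {V : Type*} [Fintype V] (G : SimpleGraph V) (x : Sym2 V → ℕ) (v : V) :
    zdeg G (fun e => (x e : ℤ)) v = (bmDeg G x v : ℤ) := by
  simp [zdeg, bmDeg]

theorem mu_exchange {V : Type*} [Fintype V] (G : SimpleGraph V) (b : V → ℕ) (w : V) (s : ℕ) :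
    mu G b w s + mu G b w (s + 3) ≤ mu G b w (s + 1) + mu G b w (s + 2) := by
  obtain ⟨x, hx0, hx1, hx2, hx3⟩ := mu_exists G b w s
  obtain ⟨y, hy0, hy1, hy2, hy3⟩ := mu_exists G b w (s + 3)
  by_cases hy : bmDeg G y w ≤ s + 2
  · have h1 := mu_le G b w _ y hy0 hy1 hy
    have h2 := mu_mono G b w (Nat.le_succ s)
    simp only [Nat.succ_eq_add_one] at h2
    omega
  have hzd : ∀ a, zdeg G (fun e => (y e : ℤ) - x e) a = bmDeg G y a - bmDeg G x a := by
    intro a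
    rw [zdeg_sub G (fun e => (y e : ℤ)) (fun e => (x e : ℤ)), zdeg_cast, zdeg_cast]
  obtain ⟨p, hp1, hp2, hp3, v, ε, hε, hp4⟩ :=
    exists_trail G _ (fun e => (y e : ℤ) - x e) rfl w (by rw [hzd]; omega)
  have hx' : ∀ e, 0 ≤ (x e : ℤ) + p e := by
    intro e; have := hp1 e; unfold Conf at this; omega
  have hy' : ∀ e, 0 ≤ (y e : ℤ) - p e := by
    intro e; have := hp1 e; unfold Conf at this; omega
  choose x' hx'e using fun e => Int.eq_ofNat_of_zero_le (hx' e)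
  choose y' hy'e using fun e => Int.eq_ofNat_of_zero_le (hy' e)
  have dx : ∀ a, (bmDeg G x' a : ℤ) = bmDeg G x a + zdeg G p a := by
    intro a
    rw [← zdeg_cast, ← zdeg_cast]
    simp only [zdeg, ← Finset.sum_add_distrib]
    exact Finset.sum_congr rfl fun e _ => (hx'e e).symm
  have dy : ∀ a, (bmDeg G y' a : ℤ) = bmDeg G y a - zdeg G p a := by
    intro a
    rw [← zdeg_cast, ← zdeg_cast]
    simp only [zdeg, ← Finset.sum_sub_distrib]
    exact Finset.sum_congr rfl fun e _ => (hy'e e).symm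
  have hcard : bmCard G x + bmCard G y = bmCard G x' + bmCard G y' := by
    simp only [bmCard, ← Finset.sum_add_distrib]
    apply Finset.sum_congr rfl
    intro e _
    have := hx'e e
    have := hy'e e
    omega
  have hx'0 : ∀ e, e ∉ G.edgeSet → x' e = 0 := by
    intro e he
    have := hx'e e
    have := hp1 e
    have := hx0 e he
    have := hy0 e he
    unfold Conf at *
    omega
  have hy'0 : ∀ e, e ∉ G.edgeSet → y' e = 0 := by
    intro e he
    have := hy'e e
    have := hp1 e
    have := hx0 e he
    have := hy0 e he
    unfold Conf at *
    omega
  have hx'1 : ∀ v, v ≠ w → bmDeg G x' v ≤ b v := by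
    intro v hv
    have := hp2 v
    rw [hzd] at this
    have := dx v
    have := hx1 v hv
    have := hy1 v hv
    unfold Conf at *
    omega
  have hy'1 : ∀ v, v ≠ w → bmDeg G y' v ≤ b v := by
    intro v hv
    have := hp2 v
    rw [hzd] at this
    have := dy v
    have := hx1 v hv
    have := hy1 v hv
    unfold Conf at *
    omega
  have hw : zdeg G p w = 1 ∨ zdeg G p w = 2 := by
    have := hp4 w
    by_cases h : w = v
    · simp [h] at this hp3 ⊢; omega
    · simp [h] at this ⊢; omega
  have hdx := dx w
  have hdy := dy w
  rw [← hx3, ← hy3, hcard]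
  rcases hw with hw | hw
  · exact add_le_add (mu_le G b w _ x' hx'0 hx'1 (by omega)) (mu_le G b w _ y' hy'0 hy'1 (by omega))
  · rw [add_comm]
    exact add_le_add (mu_le G b w _ y' hy'0 hy'1 (by omega)) (mu_le G b w _ x' hx'0 hx'1 (by omega))

theorem arith_core (f : ℕ → ℕ) (hm : Monotone f) (hl : ∀ t, f (t + 1) ≤ f t + 1)
    (he : ∀ s, f s + f (s + 3) ≤ f (s + 1) + f (s + 2)) (c d : ℕ)
    (hc : f c = f 0 + c) (hcm : ∀ t, f t = f 0 + t → t ≤ c)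
    (hd : ∀ s, s < d → f s < f d) :
    (d ≤ c → f d = f 0 + d) ∧ (c < d → Even (d - c) ∧ f d = f 0 + c + (d - c) / 2) := by
  have hs : ∀ t, f t ≤ f (t + 1) := fun t => hm (Nat.le_succ t)
  have hl' : ∀ k t, f (t + k) ≤ f t + k := by
    intro k
    induction k with
    | zero => simp
    | succ k ih => intro t; have := ih t; have := hl (t + k); rw [← add_assoc]; omega
  constructor
  · intro h
    have h1 := hl' d 0
    have h2 := hl' (c - d) d
    rw [show d + (c - d) = c by omega] at h2
    rw [zero_add] at h1
    omega
  · intro h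
    have hz : ∀ k, f (c + 2 * k + 1) = f (c + 2 * k) := by
      intro k
      induction k with
      | zero =>
        have h1 := hl c
        have h2 := hs c
        have h3 : f (c + 1) ≠ f 0 + (c + 1) := fun h => by have := hcm _ h; omega
        simp only [mul_zero, add_zero]
        omega
      | succ k ih =>
        have h1 := he (c + 2 * k)
        have h2 := hs (c + 2 * k + 2)
        rw [show c + 2 * (k + 1) = c + 2 * k + 2 by ring]
        rw [show c + 2 * k + 3 = c + 2 * k + 2 + 1 by ring] at h1
        omega
    obtain ⟨k, hk⟩ : ∃ k, d = c + 2 * k := by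
      rcases Nat.even_or_odd' (d - c) with ⟨k, hk | hk⟩
      · exact ⟨k, by omega⟩
      · exfalso
        have h1 := hz k
        have h2 := hd (c + 2 * k) (by omega)
        rw [show d = c + 2 * k + 1 by omega] at h2
        omega
    have hprop : ∀ j, f (c + 2 * j + 2) = f (c + 2 * j + 1) →
        ∀ i, f (c + 2 * (j + i) + 2) = f (c + 2 * (j + i) + 1) := by
      intro j hj i
      induction i with
      | zero => simpa using hj
      | succ i ih =>
        have h1 := he (c + 2 * (j + i) + 1)
        have h2 := hs (c + 2 * (j + i) + 3)
        rw [show c + 2 * (j + (i + 1)) + 2 = c + 2 * (j + i) + 1 + 3 by ring,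
          show c + 2 * (j + (i + 1)) + 1 = c + 2 * (j + i) + 1 + 2 by ring]
        rw [show c + 2 * (j + i) + 3 + 1 = c + 2 * (j + i) + 1 + 3 by ring,
          show c + 2 * (j + i) + 3 = c + 2 * (j + i) + 1 + 2 by ring] at h2
        rw [show c + 2 * (j + i) + 1 + 1 = c + 2 * (j + i) + 2 by ring] at h1
        omega
    have hj : ∀ j, j ≤ k → f (c + 2 * j) = f c + j := by
      intro j
      induction j with
      | zero => simp
      | succ j ih =>
        intro hjk
        have h1 := ih (by omega)
        have h2 := hz j
        have h3 := hl (c + 2 * j + 1)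
        have h4 := hs (c + 2 * j + 1)
        have h5 : f (c + 2 * j + 2) ≠ f (c + 2 * j + 1) := by
          intro hcon
          have h6 := hprop j hcon (k - 1 - j)
          have h7 := hd (c + 2 * (j + (k - 1 - j)) + 1) (by omega)
          rw [show d = c + 2 * (j + (k - 1 - j)) + 2 by omega] at h7
          omega
        rw [show c + 2 * (j + 1) = c + 2 * j + 2 by ring]
        rw [show c + 2 * j + 1 + 1 = c + 2 * j + 2 by ring] at h3 h4
        omega
    have := hj k le_rfl
    refine ⟨⟨k, by omega⟩, ?_⟩
    rw [← hk] at this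
    omega

/-- Let `t_max` be the least `t₀` with `μ(t) = μ(t₀)` for all `t ≥ t₀`, `c₁` the
largest `t` with `μ(t) = μ(0) + t`, and `c₂ = (t_max − c₁)/2`. Fix `t` and let
`d` be the minimum of `deg_x(w)` over all maximum-cardinality `b`-matchings `x`
of `G` with the capacity of `w` set to `t`. Then `d ≤ c₁ + 2c₂`; if `d ≤ c₁`
then `μ(t) = μ(0) + d`; and if `d > c₁` then `d − c₁` is even, `(d − c₁)/2 ≤ c₂`
and `μ(t) = μ(0) + c₁ + (d − c₁)/2`. -/
theorem min_degree_of_max_bmatching {V : Type*} [Fintype V] (G : SimpleGraph V)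
    (b : V → ℕ) (w : V) (tmax c₁ c₂ : ℕ)
    (htmax : ∀ t : ℕ, tmax ≤ t → mu G b w t = mu G b w tmax)
    (htmax_least : ∀ t₀ : ℕ, (∀ t : ℕ, t₀ ≤ t → mu G b w t = mu G b w t₀) → tmax ≤ t₀)
    (hc₁ : mu G b w c₁ = mu G b w 0 + c₁)
    (hc₁_max : ∀ t : ℕ, mu G b w t = mu G b w 0 + t → t ≤ c₁)
    (hc₂ : c₂ = (tmax - c₁) / 2)
    (t d : ℕ) (x : Sym2 V → ℕ)
    (hx : IsBMatching G (Function.update b w t) x)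
    (hxmax : bmCard G x = mu G b w t)
    (hxd : bmDeg G x w = d)
    (hdmin : ∀ y : Sym2 V → ℕ, IsBMatching G (Function.update b w t) y →
      bmCard G y = mu G b w t → d ≤ bmDeg G y w) :
    d ≤ c₁ + 2 * c₂ ∧
    (d ≤ c₁ → mu G b w t = mu G b w 0 + d) ∧
    (c₁ < d → Even (d - c₁) ∧ (d - c₁) / 2 ≤ c₂ ∧
      mu G b w t = mu G b w 0 + c₁ + (d - c₁) / 2) := by
  have hxw : bmDeg G x w ≤ t := by simpa using hx.2 w
  have hlow : ∀ s, s ≤ t → mu G b w s = mu G b w t → d ≤ s := by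
    intro s hs hst
    obtain ⟨y, h0, h1, h2, h3⟩ := mu_exists G b w s
    refine (hdmin y ⟨h0, fun v => ?_⟩ (h3.trans hst)).trans h2
    by_cases h : v = w
    · subst h; simpa using h2.trans hs
    · simpa [h] using h1 v h
  have hfd : mu G b w d = mu G b w t := by
    apply le_antisymm (mu_mono G b w (by omega))
    rw [← hxmax]
    refine mu_le G b w d x hx.1 (fun v hv => ?_) hxd.le
    simpa [hv] using hx.2 v
  have hd : ∀ s, s < d → mu G b w s < mu G b w d := by
    intro s hs
    refine lt_of_le_of_ne (mu_mono G b w hs.le) fun h => ?_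
    have := hlow s (by omega) (h.trans hfd)
    omega
  have hdt : d ≤ tmax := by
    rcases le_total t tmax with h | h
    · omega
    · exact hlow tmax h (htmax t h).symm
  obtain ⟨hA, hB⟩ := arith_core (mu G b w) (mu_mono G b w) (mu_succ_le G b w)
    (mu_exchange G b w) c₁ d hc₁ hc₁_max hd
  rw [← hfd]
  refine ⟨?_, hA, fun h => ?_⟩
  · rcases le_or_gt d c₁ with h | h
    · omega
    · obtain ⟨⟨k, hk⟩, -⟩ := hB h
      omega
  · obtain ⟨h1, h2⟩ := hB h
    exact ⟨h1, by omega, h2⟩
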